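/- Let (X,d) be a metric space and n a positive integer such that (P1) dim_1(X) = n + 1, and (P2) there exists an injective sequence x_1, x_2, x_3, ... of points of X such that every bisector B(u|v) (u ≠ v in X) contains at most n terms of the sequence. Then dim_k(X) = n + k for every positive integer k. -/

import Mathlib

open Set

/-- `S ⊆ X` is a `k`-metric generator for the distance function `ρ` on `X`:
every pair of distinct points of `X` is distinguished by at least `k` points of `S`. -/
def IsKMetricGenerator {X α : Type*} (ρ : X → X → α) (k : ℕ) (S : Set X) : Prop :=
  ∀ u v : X, u ≠ v → (k : ℕ∞) ≤ {w ∈ S | ρ u w ≠ ρ v w}.encard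

/-- The `k`-metric dimension of `X` with respect to the distance function `ρ`:
the infimum of the cardinalities of finite `k`-metric generators, `⊤` if none exists. -/
noncomputable def kMetricDim {X α : Type*} (ρ : X → X → α) (k : ℕ) : ℕ∞ :=
  sInf {n : ℕ∞ | ∃ S : Finset X, IsKMetricGenerator ρ k ↑S ∧ n = S.card}

open Classical in
/-- For a finite set, being a `k`-metric generator can be tested with `Finset` cardinalities. -/
theorem isKMetricGenerator_coe_iff {X α : Type*} (ρ : X → X → α) (k : ℕ) (S : Finset X) :
    IsKMetricGenerator ρ k ↑S ↔
      ∀ u v : X, u ≠ v → k ≤ (S.filter fun w => ρ u w ≠ ρ v w).card := by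
  refine forall₃_congr fun u v _ => ?_
  have h : {w ∈ (S : Set X) | ρ u w ≠ ρ v w} = ↑(S.filter fun w => ρ u w ≠ ρ v w) := by
    ext w
    simp
  rw [h, Set.encard_coe_eq_coe_finsetCard, Nat.cast_le]

/-- A finite `k`-metric generator bounds the `k`-metric dimension from above. -/
theorem kMetricDim_le_card {X α : Type*} {ρ : X → X → α} {k : ℕ} {S : Finset X}
    (hS : IsKMetricGenerator ρ k ↑S) : kMetricDim ρ k ≤ S.card :=
  sInf_le ⟨S, hS, rfl⟩

/-- Removing `j` points from a finite `(k + j)`-metric generator leaves a `k`-metric generator. -/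
theorem kMetricDim_add_le {X α : Type*} [Nontrivial X] (ρ : X → X → α) (k j : ℕ) :
    kMetricDim ρ k + j ≤ kMetricDim ρ (k + j) := by
  classical
  refine le_sInf ?_
  rintro _ ⟨S, hS, rfl⟩
  rw [isKMetricGenerator_coe_iff] at hS
  obtain ⟨a, b, hab⟩ := exists_pair_ne X
  have hj : j ≤ S.card := by
    have := (hS a b hab).trans (Finset.card_filter_le _ _)
    omega
  obtain ⟨R, hRS, hR⟩ := Finset.exists_subset_card_eq hj
  have hgen : IsKMetricGenerator ρ k ↑(S \ R) := by
    rw [isKMetricGenerator_coe_iff]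
    intro u v huv
    have hle := hS u v huv
    have hsub : (S.filter fun w => ρ u w ≠ ρ v w) ⊆
        ((S \ R).filter fun w => ρ u w ≠ ρ v w) ∪ R := by
      intro w hw
      simp only [Finset.mem_union, Finset.mem_filter, Finset.mem_sdiff] at hw ⊢
      tauto
    have hcard := (Finset.card_le_card hsub).trans (Finset.card_union_le _ _)
    omega
  have hcard : (S \ R).card + j = S.card := by
    rw [← hR]
    exact Finset.card_sdiff_add_card_eq_card hRS
  rw [← hcard, Nat.cast_add]
  gcongr
  exact kMetricDim_le_card hgen

/-- If every bisector contains at most `n` terms of an injective sequence, then the first `n + k`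
terms form a `k`-metric generator. -/
theorem kMetricDim_le_of_bisector {X : Type*} [MetricSpace X] {n : ℕ} {x : ℕ → X}
    (hinj : Function.Injective x)
    (hbis : ∀ u v : X, u ≠ v →
      {i : ℕ | dist (x i) u = dist (x i) v}.encard ≤ (n : ℕ∞)) (k : ℕ) :
    kMetricDim (fun x y : X => dist x y) k ≤ (n : ℕ∞) + (k : ℕ∞) := by
  classical
  have hgen : IsKMetricGenerator (fun x y : X => dist x y) k
      ↑((Finset.range (n + k)).image x) := by
    rw [isKMetricGenerator_coe_iff]
    intro u v huv
    rw [Finset.filter_image, Finset.card_image_of_injective _ hinj]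
    have hsplit := Finset.card_filter_add_card_filter_not (s := Finset.range (n + k))
      (fun i => dist u (x i) = dist v (x i))
    have hle : ((Finset.range (n + k)).filter fun i => dist u (x i) = dist v (x i)).card ≤ n := by
      rw [← Nat.cast_le (α := ℕ∞), ← Set.encard_coe_eq_coe_finsetCard]
      refine (Set.encard_le_encard fun i hi => ?_).trans (hbis u v huv)
      rw [Finset.mem_coe, Finset.mem_filter] at hi
      simpa [dist_comm] using hi.2
    rw [Finset.card_range] at hsplit
    simp only [ne_eq]
    omega
  simpa [Finset.card_image_of_injective _ hinj] using kMetricDim_le_card hgen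

/-- Let `X` be a metric space (with at least three points) and `n ≥ 1`
such that (P1) `dim_1(X) = n + 1`, and (P2) there is an injective sequence `x₁, x₂, …` in
`X` such that every bisector contains at most `n` terms of the sequence. Then
`dim_k(X) = n + k` for every positive integer `k`. -/
theorem kMetricDim_of_P1_P2 {X : Type*} [MetricSpace X]
    (hX : ∃ a b c : X, a ≠ b ∧ a ≠ c ∧ b ≠ c) (n : ℕ) (hn : 1 ≤ n)
    (hP1 : kMetricDim (fun x y : X => dist x y) 1 = (n : ℕ∞) + 1)
    (x : ℕ → X) (hinj : Function.Injective x)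
    (hP2 : ∀ u v : X, u ≠ v →
      {i : ℕ | dist (x i) u = dist (x i) v}.encard ≤ (n : ℕ∞)) :
    ∀ k : ℕ, 1 ≤ k →
      kMetricDim (fun x y : X => dist x y) k = (n : ℕ∞) + (k : ℕ∞) := by
  intro k hk
  refine le_antisymm (kMetricDim_le_of_bisector hinj hP2 k) ?_
  obtain ⟨a, b, _, hab, _⟩ := hX
  have : Nontrivial X := ⟨a, b, hab⟩
  obtain ⟨j, rfl⟩ := Nat.exists_eq_add_of_le hk
  have h := kMetricDim_add_le (fun x y : X => dist x y) 1 j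
  rw [hP1] at h
  simpa [add_assoc] using h
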